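/- Let f and ν satisfy the strongly adapted coordinate conditions at a non-degenerate singular point p = (0,0) of the second kind as in the context, with ε(u) ≠ 0 for u ≠ 0, f_uu(0,0) ≠ 0, and f_u(u,0) ≠ 0 for u ≠ 0 near 0. With γ̂(u) := f(u,0), t(u) := ∫₀ᵘ ‖f_u(w,0)‖ dw, and |κ_c(u)| the unsigned cuspidal curvature defined for u ≠ 0 by |κ_c(u)| := ‖f_u(u,0)‖^{3/2}·|det(f_u(u,0), f_ηη(u,0), f_ηηη(u,0))|/‖f_u(u,0) × f_ηη(u,0)‖^{5/2} (where f_η := f_u + ε(u) f_v, f_ηη := ∂_u f_η + ε(u) ∂_v f_η, f_ηηη := ∂_u f_ηη + ε(u) ∂_v f_ηη), the limiting cuspidal curvature satisfies τ_c := (√(2√2)/2) · lim_{u→0} |t(u)|^{1/4} · |κ_c(u)| = √(τ_s) · |κ_H(p)|, where τ_s := |det(f_uu(0,0), f_uuu(0,0), ν(0,0))| / ‖f_uu(0,0)‖^{5/2} and κ_H(p) := −⟨f_uv(0,0), ∂_u ν(0,0)⟩ / ‖f_uv(0,0)‖². -/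

import Mathlib

open scoped RealInnerProductSpace
open Filter

noncomputable section

/-- Euclidean 3-space. -/
abbrev E3 : Type := EuclideanSpace ℝ (Fin 3)

/-- Partial derivative in the first (`u`) direction. -/
def pu {E : Type*} [NormedAddCommGroup E] [NormedSpace ℝ E] (f : ℝ × ℝ → E) (q : ℝ × ℝ) : E :=
  fderiv ℝ f q (1, 0)

/-- Partial derivative in the second (`v`) direction. -/
def pv {E : Type*} [NormedAddCommGroup E] [NormedSpace ℝ E] (f : ℝ × ℝ → E) (q : ℝ × ℝ) : E :=
  fderiv ℝ f q (0, 1)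

/-- Determinant of three column vectors in `ℝ³`. -/
def det3 (a b c : E3) : ℝ :=
  Matrix.det !![a 0, b 0, c 0; a 1, b 1, c 1; a 2, b 2, c 2]

/-- Cross product in `ℝ³`. -/
def cross3 (a b : E3) : E3 :=
  (WithLp.equiv 2 (Fin 3 → ℝ)).symm
    ![a 1 * b 2 - a 2 * b 1, a 2 * b 0 - a 0 * b 2, a 0 * b 1 - a 1 * b 0]

theorem contDiff_pu {E : Type*} [NormedAddCommGroup E] [NormedSpace ℝ E] {g : ℝ × ℝ → E}
    (hg : ContDiff ℝ (⊤ : ℕ∞) g) : ContDiff ℝ (⊤ : ℕ∞) (pu g) :=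
  (hg.fderiv_right (m := (⊤ : ℕ∞)) (by simp)).clm_apply contDiff_const

theorem contDiff_pv {E : Type*} [NormedAddCommGroup E] [NormedSpace ℝ E] {g : ℝ × ℝ → E}
    (hg : ContDiff ℝ (⊤ : ℕ∞) g) : ContDiff ℝ (⊤ : ℕ∞) (pv g) :=
  (hg.fderiv_right (m := (⊤ : ℕ∞)) (by simp)).clm_apply contDiff_const

theorem pv_pu_comm {E : Type*} [NormedAddCommGroup E] [NormedSpace ℝ E] {g : ℝ × ℝ → E}
    (hg : ContDiff ℝ (⊤ : ℕ∞) g) : pv (pu g) = pu (pv g) := by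
  funext q
  have hd : DifferentiableAt ℝ (fderiv ℝ g) q :=
    ((hg.fderiv_right (m := (⊤ : ℕ∞)) (by simp)).differentiable (by simp)) q
  have hs : IsSymmSndFDerivAt ℝ g q :=
    hg.contDiffAt.isSymmSndFDerivAt
      (by simpa using WithTop.coe_le_coe.2 (le_top (a := (2 : ℕ∞))))
  have h (w x : ℝ × ℝ) :
      fderiv ℝ (fun p => fderiv ℝ g p w) q x = fderiv ℝ (fderiv ℝ g) q x w := by
    rw [fderiv_clm_apply hd (differentiableAt_const w)]
    simp
  change fderiv ℝ (fun p => fderiv ℝ g p (1, 0)) q (0, 1) =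
    fderiv ℝ (fun p => fderiv ℝ g p (0, 1)) q (1, 0)
  rw [h, h]
  exact hs (0, 1) (1, 0)

theorem hasDerivAt_pu {E : Type*} [NormedAddCommGroup E] [NormedSpace ℝ E] {g : ℝ × ℝ → E}
    (hg : ContDiff ℝ (⊤ : ℕ∞) g) (u v : ℝ) :
    HasDerivAt (fun w : ℝ => g (w, v)) (pu g (u, v)) u :=
  ((hg.differentiable (by simp)) (u, v)).hasFDerivAt.comp_hasDerivAt u
    ((hasDerivAt_id u).prodMk (hasDerivAt_const u v))

theorem hasDerivAt_pv {E : Type*} [NormedAddCommGroup E] [NormedSpace ℝ E] {g : ℝ × ℝ → E}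
    (hg : ContDiff ℝ (⊤ : ℕ∞) g) (u v : ℝ) :
    HasDerivAt (fun w : ℝ => g (u, w)) (pv g (u, v)) v :=
  ((hg.differentiable (by simp)) (u, v)).hasFDerivAt.comp_hasDerivAt v
    ((hasDerivAt_const v u).prodMk (hasDerivAt_id v))

theorem contDiff_add_smul {E : Type*} [NormedAddCommGroup E] [NormedSpace ℝ E]
    {g k : ℝ × ℝ → E} {c : ℝ → ℝ} (hg : ContDiff ℝ (⊤ : ℕ∞) g) (hk : ContDiff ℝ (⊤ : ℕ∞) k)
    (hc : ContDiff ℝ (⊤ : ℕ∞) c) :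
    ContDiff ℝ (⊤ : ℕ∞) (fun q : ℝ × ℝ => g q + c q.1 • k q) :=
  hg.add ((hc.comp contDiff_fst).smul hk)

theorem pu_add_smul {E : Type*} [NormedAddCommGroup E] [NormedSpace ℝ E]
    {g k : ℝ × ℝ → E} {c : ℝ → ℝ} (hg : ContDiff ℝ (⊤ : ℕ∞) g) (hk : ContDiff ℝ (⊤ : ℕ∞) k)
    (hc : ContDiff ℝ (⊤ : ℕ∞) c) (q : ℝ × ℝ) :
    pu (fun q : ℝ × ℝ => g q + c q.1 • k q) q =
      pu g q + (c q.1 • pu k q + deriv c q.1 • k q) :=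
  (hasDerivAt_pu (contDiff_add_smul hg hk hc) q.1 q.2).unique
    ((hasDerivAt_pu hg q.1 q.2).add
      (((hc.differentiable (by simp)) q.1).hasDerivAt.smul (hasDerivAt_pu hk q.1 q.2)))

theorem pv_add_smul {E : Type*} [NormedAddCommGroup E] [NormedSpace ℝ E]
    {g k : ℝ × ℝ → E} {c : ℝ → ℝ} (hg : ContDiff ℝ (⊤ : ℕ∞) g) (hk : ContDiff ℝ (⊤ : ℕ∞) k)
    (hc : ContDiff ℝ (⊤ : ℕ∞) c) (q : ℝ × ℝ) :
    pv (fun q : ℝ × ℝ => g q + c q.1 • k q) q = pv g q + c q.1 • pv k q :=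
  (hasDerivAt_pv (contDiff_add_smul hg hk hc) q.1 q.2).unique
    ((hasDerivAt_pv hg q.1 q.2).add ((hasDerivAt_pv hk q.1 q.2).const_smul (c q.1)))

theorem eventually_pu_eq_zero {E : Type*} [NormedAddCommGroup E] [NormedSpace ℝ E]
    {g : ℝ × ℝ → E} (hg : ContDiff ℝ (⊤ : ℕ∞) g) {x y : ℝ} (h : ∀ᶠ u in nhds x, g (u, y) = 0) :
    ∀ᶠ u in nhds x, pu g (u, y) = 0 := by
  filter_upwards [h.eventually_nhds] with u hu
  exact (hasDerivAt_pu hg u y).unique ((hasDerivAt_const u (0 : E)).congr_of_eventuallyEq hu)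

theorem det3_eq (a b c : E3) : det3 a b c =
    a 0 * b 1 * c 2 - a 0 * c 1 * b 2 - b 0 * a 1 * c 2 + b 0 * c 1 * a 2 +
      c 0 * a 1 * b 2 - c 0 * b 1 * a 2 := by
  simp [det3, Matrix.det_fin_three]

theorem inner_E3 (a b : E3) : ⟪a, b⟫ = a 0 * b 0 + a 1 * b 1 + a 2 * b 2 := by
  simp [PiLp.inner_apply, Fin.sum_univ_three, mul_comm]

theorem det3_mul_det3 (a b c d : E3) :
    det3 a b c * det3 a b d =
      ⟪a, a⟫ * (⟪b, b⟫ * ⟪c, d⟫ - ⟪b, d⟫ * ⟪b, c⟫) - ⟪a, b⟫ * (⟪a, b⟫ * ⟪c, d⟫ - ⟪b, d⟫ * ⟪a, c⟫) +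
        ⟪a, d⟫ * (⟪a, b⟫ * ⟪b, c⟫ - ⟪b, b⟫ * ⟪a, c⟫) := by
  simp only [det3_eq, inner_E3]
  ring

theorem norm_cross3_sq (a b : E3) :
    ‖cross3 a b‖ ^ 2 = ‖a‖ ^ 2 * ‖b‖ ^ 2 - ⟪a, b⟫ ^ 2 := by
  simp only [← real_inner_self_eq_norm_sq, inner_E3, cross3]
  simp
  ring

theorem cross3_smul_smul (r s : ℝ) (a b : E3) :
    cross3 (r • a) (s • b) = (r * s) • cross3 a b := by
  ext i
  fin_cases i <;> simp [cross3] <;> ring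

/-- For orthogonal `a`, `b` with `‖a‖ = 1` and a unit normal `n` of their plane, the determinant
measures the normal component. -/
theorem abs_det3_of_orthogonal {a b n : E3} (ha : ‖a‖ = 1) (hab : ⟪a, b⟫ = 0) (hn : ‖n‖ = 1)
    (hna : ⟪n, a⟫ = 0) (hnb : ⟪n, b⟫ = 0) (c : E3) : |det3 a b c| = ‖b‖ * |⟪n, c⟫| := by
  have haa : ⟪a, a⟫ = 1 := by rw [real_inner_self_eq_norm_sq, ha]; norm_num
  have hnn : ⟪n, n⟫ = 1 := by rw [real_inner_self_eq_norm_sq, hn]; norm_num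
  have han : ⟪a, n⟫ = 0 := by rw [real_inner_comm]; exact hna
  have hbn : ⟪b, n⟫ = 0 := by rw [real_inner_comm]; exact hnb
  have hc := det3_mul_det3 a b n c
  have hs := det3_mul_det3 a b n n
  simp only [haa, hab, han, hbn, hnn, real_inner_self_eq_norm_sq b] at hc hs
  rcases eq_or_ne b 0 with rfl | hb
  · simp [det3_eq]
  · have hb' : 0 < ‖b‖ := norm_pos_iff.2 hb
    have hsn : |det3 a b n| = ‖b‖ := by
      rw [← abs_of_pos hb', ← sq_eq_sq_iff_abs_eq_abs]
      nlinarith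
    have := congrArg abs hc
    rw [abs_mul, hsn] at this
    have h2 : ‖b‖ * |det3 a b c| = ‖b‖ * (‖b‖ * |⟪n, c⟫|) := by
      rw [this]
      simp [abs_mul]
      ring
    exact mul_left_cancel₀ hb'.ne' h2

theorem exists_pow_eq_of_pos {x : ℝ} (hx : 0 < x) {n : ℕ} (hn : n ≠ 0) :
    ∃ y : ℝ, 0 < y ∧ y ^ n = x :=
  ⟨x ^ (n⁻¹ : ℝ), Real.rpow_pos_of_pos hx _, Real.rpow_inv_natCast_pow hx.le hn⟩

theorem pow_rpow_eq {y p : ℝ} (hy : 0 ≤ y) {n m : ℕ} (h : (n : ℝ) * p = m) :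
    (y ^ n) ^ p = y ^ m := by
  rw [← Real.rpow_natCast, ← Real.rpow_mul hy, h, Real.rpow_natCast]

theorem rpow_scaling {T x n D N : ℝ} (hT : 0 ≤ T) (hx : 0 < x) (hn : 0 ≤ n) (hN : 0 ≤ N) :
    T ^ ((1 : ℝ) / 4) * ((x * n) ^ ((3 : ℝ) / 2) * (x ^ 3 * D) / (x ^ 2 * N) ^ ((5 : ℝ) / 2)) =
      (T / x ^ 2) ^ ((1 : ℝ) / 4) * (n ^ ((3 : ℝ) / 2) * D / N ^ ((5 : ℝ) / 2)) := by
  obtain ⟨s, hs, rfl⟩ := exists_pow_eq_of_pos hx two_ne_zero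
  rw [Real.mul_rpow (by positivity) hn, Real.mul_rpow (by positivity) hN,
    Real.div_rpow hT (by positivity), ← pow_mul, ← pow_mul,
    pow_rpow_eq hs.le (m := 3) (by norm_num), pow_rpow_eq hs.le (m := 10) (by norm_num),
    pow_rpow_eq hs.le (m := 1) (by norm_num)]
  field_simp
  ring

theorem limit_value_eq {e A w : ℝ} (he : 0 < e) (hA : 0 < A) :
    Real.sqrt (2 * Real.sqrt 2) / 2 *
        ((e / 2 / e ^ 2) ^ ((1 : ℝ) / 4) * (2 * (A * w) / A ^ ((5 : ℝ) / 2))) =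
      Real.sqrt (2 * e ^ 2 * A / e ^ ((5 : ℝ) / 2)) * (w / A ^ 2) := by
  obtain ⟨s, hs, rfl⟩ := exists_pow_eq_of_pos he (n := 4) (by norm_num)
  obtain ⟨r, hr, rfl⟩ := exists_pow_eq_of_pos hA two_ne_zero
  obtain ⟨q, hq, hq2⟩ := exists_pow_eq_of_pos (zero_lt_two (α := ℝ)) (n := 4) (by norm_num)
  have h1 : s ^ 4 / 2 / (s ^ 4) ^ 2 = (1 / (q * s)) ^ 4 := by
    rw [← hq2]; field_simp
  have h2 : Real.sqrt 2 = q ^ 2 := by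
    rw [← hq2, show q ^ 4 = (q ^ 2) ^ 2 by ring, Real.sqrt_sq (by positivity)]
  have h3 : Real.sqrt (2 * q ^ 2) = q ^ 3 := by
    rw [← hq2, show q ^ 4 * q ^ 2 = (q ^ 3) ^ 2 by ring, Real.sqrt_sq (by positivity)]
  have h4 : 2 * (s ^ 4) ^ 2 * r ^ 2 / s ^ 10 = (q ^ 2 * r / s) ^ 2 := by
    rw [← hq2]; field_simp
  rw [h1, h2, h3, pow_rpow_eq (by positivity) (m := 1) (by norm_num),
    pow_rpow_eq hr.le (m := 5) (by norm_num), pow_rpow_eq hs.le (m := 10) (by norm_num), h4,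
    Real.sqrt_sq (by positivity)]
  field_simp

theorem tendsto_norm_div_abs {E : Type*} [NormedAddCommGroup E] [NormedSpace ℝ E] {g : ℝ → E}
    {g' : E} (hg : HasDerivAt g g' 0) (h0 : g 0 = 0) :
    Tendsto (fun u => ‖g u‖ / |u|) (nhdsWithin 0 {0}ᶜ) (nhds ‖g'‖) := by
  have h := (hasDerivAt_iff_tendsto_slope.1 hg).norm
  refine h.congr fun u => ?_
  simp [slope_def_module, h0, norm_smul, div_eq_inv_mul]

theorem hasDerivAt_mul_abs {u : ℝ} (hu : u ≠ 0) :
    HasDerivAt (fun w : ℝ => w * |w|) (2 * |u|) u := by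
  refine ((hasDerivAt_id u).mul (hasDerivAt_abs hu)).congr_deriv ?_
  rcases lt_or_gt_of_ne hu with h | h
  · simp [h, abs_of_neg h]; ring
  · simp [h, abs_of_pos h]; ring

/-- The speed integral of a curve whose velocity `g` vanishes at `0` is asymptotic to half the norm
of the derivative of `g` at `0` times `u * |u|`. -/
theorem tendsto_integral_norm_div {E : Type*} [NormedAddCommGroup E] [NormedSpace ℝ E] {g : ℝ → E}
    {g' : E} (hc : Continuous g) (hg : HasDerivAt g g' 0) (h0 : g 0 = 0) :
    Tendsto (fun u => (∫ w in (0 : ℝ)..u, ‖g w‖) / (u * |u|)) (nhdsWithin 0 {0}ᶜ)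
      (nhds (‖g'‖ / 2)) := by
  have hd (u : ℝ) : HasDerivAt (fun u => ∫ w in (0 : ℝ)..u, ‖g w‖) ‖g u‖ u :=
    intervalIntegral.integral_hasDerivAt_right (hc.norm.intervalIntegrable _ _)
      (hc.norm.stronglyMeasurableAtFilter _ _) hc.norm.continuousAt
  have hne : ∀ᶠ u : ℝ in nhdsWithin 0 {0}ᶜ, u ≠ 0 := self_mem_nhdsWithin
  refine HasDerivAt.lhopital_zero_nhdsNE (f' := fun u => ‖g u‖) (g' := fun u => 2 * |u|)
    (.of_forall hd) (hne.mono fun u hu => hasDerivAt_mul_abs hu)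
    (hne.mono fun u hu => by positivity) ?_ ?_ ?_
  · have := (hd 0).continuousAt.tendsto
    simp only [intervalIntegral.integral_same] at this
    exact this.mono_left nhdsWithin_le_nhds
  · have : Continuous fun u : ℝ => u * |u| := by fun_prop
    have := this.tendsto 0
    simp only [zero_mul] at this
    exact this.mono_left nhdsWithin_le_nhds
  · refine ((tendsto_norm_div_abs hg h0).div_const 2).congr fun u => ?_
    rw [div_div, mul_comm]

theorem continuous_det3 {X : Type*} [TopologicalSpace X] {a b c : X → E3} (ha : Continuous a)
    (hb : Continuous b) (hc : Continuous c) : Continuous fun x => det3 (a x) (b x) (c x) := by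
  simp only [det3_eq]
  fun_prop

theorem continuous_cross3 {X : Type*} [TopologicalSpace X] {a b : X → E3} (ha : Continuous a)
    (hb : Continuous b) : Continuous fun x => cross3 (a x) (b x) := by
  refine (PiLp.continuous_toLp 2 (fun _ : Fin 3 => ℝ)).comp (continuous_pi fun i => ?_)
  fin_cases i <;> simp <;> fun_prop

theorem det3_neg_smul_smul_add_smul (r s : ℝ) (a b c : E3) :
    det3 (-(r • a)) (r • b) (s • b + r • c) = -(r ^ 3 * det3 a b c) := by
  simp [det3_eq]
  ring

theorem det3_smul_add_smul_right (r s x : ℝ) (a b n : E3) :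
    det3 (r • a) (s • a + x • b) n = r * x * det3 a b n := by
  simp [det3_eq]
  ring

theorem det3_smul_right (r : ℝ) (a b c : E3) : det3 a b (r • c) = r * det3 a b c := by
  simp [det3_eq]
  ring

theorem inner_pu_add_inner_pu {g n : ℝ × ℝ → E3} (hg : ContDiff ℝ (⊤ : ℕ∞) g)
    (hn : ContDiff ℝ (⊤ : ℕ∞) n) {x y : ℝ} (h : ∀ᶠ u in nhds x, ⟪n (u, y), g (u, y)⟫ = 0) :
    ⟪n (x, y), pu g (x, y)⟫ + ⟪pu n (x, y), g (x, y)⟫ = 0 :=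
  ((hasDerivAt_pu hn x y).inner ℝ (hasDerivAt_pu hg x y)).unique
    ((hasDerivAt_const x (0 : ℝ)).congr_of_eventuallyEq h)

theorem inner_pv_add_inner_pv {g n : ℝ × ℝ → E3} (hg : ContDiff ℝ (⊤ : ℕ∞) g)
    (hn : ContDiff ℝ (⊤ : ℕ∞) n) {x y : ℝ} (h : ∀ᶠ v in nhds y, ⟪n (x, v), g (x, v)⟫ = 0) :
    ⟪n (x, y), pv g (x, y)⟫ + ⟪pv n (x, y), g (x, y)⟫ = 0 :=
  ((hasDerivAt_pv hn x y).inner ℝ (hasDerivAt_pv hg x y)).unique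
    ((hasDerivAt_const y (0 : ℝ)).congr_of_eventuallyEq h)

/-- **Limiting cuspidal curvature at a swallowtail.** In strongly adapted coordinates at a
non-degenerate singular point of the second kind, with `t(u) = ∫₀ᵘ ‖f_u(w,0)‖ dw`, the
limiting cuspidal curvature satisfies
`(√(2√2)/2)·|t(u)|^{1/4}·|κ_c(u)| → √τ_s·|κ_H(p)|` as `u → 0`, where
`τ_s = |det(f_uu, f_uuu, ν)(0,0)|/‖f_uu(0,0)‖^{5/2}` and
`κ_H(p) = −⟨f_uv, ν_u⟩(0,0)/‖f_uv(0,0)‖²`. -/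
theorem limiting_cuspidal_curvature_at_swallowtail
    (f ν : ℝ × ℝ → E3) (ε : ℝ → ℝ)
    (hf : ContDiff ℝ (⊤ : ℕ∞) f) (hν : ContDiff ℝ (⊤ : ℕ∞) ν)
    (hfrontal : ∀ q : ℝ × ℝ, ‖ν q‖ = 1 ∧ ⟪ν q, pu f q⟫ = 0 ∧ ⟪ν q, pv f q⟫ = 0)
    (hε : ContDiff ℝ (⊤ : ℕ∞) ε) (hε0 : ε 0 = 0)
    (hfu0 : pu f (0, 0) = 0) (hfv1 : ‖pv f (0, 0)‖ = 1)
    (hnull : ∀ᶠ u in nhds (0 : ℝ), pu f (u, 0) + ε u • pv f (u, 0) = 0)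
    (hnd : LinearIndependent ℝ ![pv (pu f) (0, 0), pv f (0, 0)])
    (hperp : ⟪pv (pu f) (0, 0), pv f (0, 0)⟫ = 0)
    (hεne : ∀ᶠ u in nhdsWithin (0 : ℝ) {0}ᶜ, ε u ≠ 0)
    (hfuu : pu (pu f) (0, 0) ≠ 0)
    (hfune : ∀ᶠ u in nhdsWithin (0 : ℝ) {0}ᶜ, pu f (u, 0) ≠ 0) :
    let fη : ℝ × ℝ → E3 := fun q => pu f q + ε q.1 • pv f q
    let fηη : ℝ × ℝ → E3 := fun q => pu fη q + ε q.1 • pv fη q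
    let fηηη : ℝ × ℝ → E3 := fun q => pu fηη q + ε q.1 • pv fηη q
    let κc : ℝ → ℝ := fun u =>
      ‖pu f (u, 0)‖ ^ ((3 : ℝ) / 2) *
          det3 (pu f (u, 0)) (fηη (u, 0)) (fηηη (u, 0)) /
        ‖cross3 (pu f (u, 0)) (fηη (u, 0))‖ ^ ((5 : ℝ) / 2)
    Tendsto (fun u : ℝ =>
        Real.sqrt (2 * Real.sqrt 2) / 2 *
          (|∫ w in (0 : ℝ)..u, ‖pu f (w, 0)‖| ^ ((1 : ℝ) / 4) * |κc u|))
      (nhdsWithin 0 {0}ᶜ)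
      (nhds (Real.sqrt
          (|det3 (pu (pu f) (0, 0)) (pu (pu (pu f)) (0, 0)) (ν (0, 0))| /
            ‖pu (pu f) (0, 0)‖ ^ ((5 : ℝ) / 2)) *
        |(-⟪pv (pu f) (0, 0), pu ν (0, 0)⟫) / ‖pv (pu f) (0, 0)‖ ^ 2|)) := by
  intro fη fηη fηηη κc
  have hpu := contDiff_pu hf
  have hpv := contDiff_pv hf
  have hfη : ContDiff ℝ (⊤ : ℕ∞) fη := contDiff_add_smul hpu hpv hε
  have hu := contDiff_pu hfη
  have hv := contDiff_pv hfη
  have hε' : ContDiff ℝ (⊤ : ℕ∞) (deriv ε) := by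
    exact hε.iterate_deriv 1
  have hcx : Continuous fun u : ℝ => ((u, 0) : ℝ × ℝ) := by fun_prop
  -- Vanishing of `f_η` and of its `u`-derivatives along the singular curve.
  have h0 : ∀ᶠ u in nhds (0 : ℝ), fη (u, 0) = 0 := hnull
  have h1 := eventually_pu_eq_zero hfη h0
  have h2 := eventually_pu_eq_zero hu h1
  -- Values at the origin.
  have hsym : pv (pu f) = pu (pv f) := pv_pu_comm hf
  have hA0 : pv fη (0, 0) = pv (pu f) (0, 0) := by
    simp [fη, pv_add_smul hpu hpv hε, hε0]
  have hfuu0 : pu (pu f) (0, 0) = -deriv ε 0 • pv f (0, 0) := by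
    have := h1.self_of_nhds
    simp only [fη, pu_add_smul hpu hpv hε, hε0, zero_smul, zero_add] at this
    rw [neg_smul]
    exact eq_neg_of_add_eq_zero_left this
  have hfuuu0 : pu (pu (pu f)) (0, 0) =
      -deriv (deriv ε) 0 • pv f (0, 0) + (-2 * deriv ε 0) • pv (pu f) (0, 0) := by
    have := h2.self_of_nhds
    have hfun : pu fη = fun q : ℝ × ℝ =>
        (fun q : ℝ × ℝ => pu (pu f) q + ε q.1 • pu (pv f) q) q + deriv ε q.1 • pv f q := by
      funext q
      simp only [fη, pu_add_smul hpu hpv hε, add_assoc]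
    rw [hfun, pu_add_smul (contDiff_add_smul (contDiff_pu hpu) (contDiff_pu hpv) hε) hpv hε',
      pu_add_smul (contDiff_pu hpu) (contDiff_pu hpv) hε] at this
    simp only [hε0, zero_smul, zero_add] at this
    rw [hsym]
    rw [← sub_eq_zero, ← this]
    module
  have he : 0 < |deriv ε 0| := by
    rw [abs_pos]
    intro h
    exact hfuu (by rw [hfuu0, h]; simp)
  have hnuu : ‖pu (pu f) (0, 0)‖ = |deriv ε 0| := by
    rw [hfuu0, norm_smul, hfv1]; simp
  have hA : 0 < ‖pv (pu f) (0, 0)‖ := norm_pos_iff.2 (hnd.ne_zero 0)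
  have hperp' : ⟪pv f (0, 0), pv (pu f) (0, 0)⟫ = 0 := by
    rw [real_inner_comm]; exact hperp
  obtain ⟨hν1, -, hνv⟩ := hfrontal (0, 0)
  -- The limiting normal is orthogonal to `∂_v f_η` along the singular curve.
  have hνA : ∀ᶠ u in nhds (0 : ℝ), ⟪ν (u, 0), pv fη (u, 0)⟫ = 0 := by
    filter_upwards [h0] with u hu0
    have := inner_pv_add_inner_pv (x := u) (y := 0) hfη hν (.of_forall fun v => by
      simp only [fη, inner_add_right, inner_smul_right, (hfrontal (u, v)).2.1,
        (hfrontal (u, v)).2.2]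
      ring)
    simpa [hu0] using this
  have hνA0 : ⟪ν (0, 0), pv (pu f) (0, 0)⟫ = 0 := by
    rw [← hA0]; exact hνA.self_of_nhds
  have hνA' : |⟪ν (0, 0), pu (pv fη) (0, 0)⟫| = |⟪pv (pu f) (0, 0), pu ν (0, 0)⟫| := by
    have := inner_pu_add_inner_pu hv hν hνA
    rw [hA0] at this
    rw [eq_neg_of_add_eq_zero_left this, abs_neg, real_inner_comm]
  have hdet := abs_det3_of_orthogonal hfv1 hperp' hν1 hνv hνA0
  -- The factor of `κ_c` which stays regular at the origin.
  set G : ℝ → ℝ := fun u => ‖pv f (u, 0)‖ ^ ((3 : ℝ) / 2) *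
    |det3 (pv f (u, 0)) (pv fη (u, 0))
      ((2 : ℝ) • pu (pv fη) (u, 0) + ε u • pv (pv fη) (u, 0))| /
    ‖cross3 (pv f (u, 0)) (pv fη (u, 0))‖ ^ ((5 : ℝ) / 2) with hG
  have hcross0 : ‖cross3 (pv f (0, 0)) (pv fη (0, 0))‖ = ‖pv (pu f) (0, 0)‖ := by
    rw [← sq_eq_sq₀ (norm_nonneg _) (norm_nonneg _), norm_cross3_sq, hA0, hfv1, hperp']
    ring
  have hcF := hpv.continuous.comp hcx
  have hcA := hv.continuous.comp hcx
  have hcD := continuous_det3 hcF hcA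
    ((((contDiff_pu hv).continuous.comp hcx).const_smul (2 : ℝ)).add
      (hε.continuous.smul ((contDiff_pv hv).continuous.comp hcx)))
  have hcN := (continuous_cross3 hcF hcA).norm
  have hGc : Tendsto G (nhds 0) (nhds (G 0)) := by
    refine ContinuousAt.div ?_ ?_ ?_
    · exact (hcF.norm.continuousAt.rpow_const (Or.inr (by norm_num))).mul hcD.abs.continuousAt
    · exact hcN.continuousAt.rpow_const (Or.inr (by norm_num))
    · rw [hcross0]
      positivity
  have hG0 : G 0 = 2 * (‖pv (pu f) (0, 0)‖ * |⟪pv (pu f) (0, 0), pu ν (0, 0)⟫|) /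
      ‖pv (pu f) (0, 0)‖ ^ ((5 : ℝ) / 2) := by
    simp only [hG, hcross0]
    rw [hA0, hε0, hfv1, zero_smul, add_zero, det3_smul_right, abs_mul, hdet, hνA']
    simp
  have hT := (tendsto_integral_norm_div (hpu.continuous.comp hcx) (hasDerivAt_pu hpu 0 0)
    hfu0).abs
  have hE := (tendsto_norm_div_abs ((hε.differentiable (by simp)) 0).hasDerivAt hε0).pow 2
  have hlim := (((hT.div hE (by simpa using he.ne')).rpow_const
    (p := (1 : ℝ) / 4) (Or.inr (by norm_num))).mul
      (hGc.mono_left nhdsWithin_le_nhds)).const_mul (Real.sqrt (2 * Real.sqrt 2) / 2)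
  rw [hG0, hnuu, Real.norm_eq_abs, abs_of_pos (half_pos he), limit_value_eq he hA] at hlim
  have hτ : |det3 (pu (pu f) (0, 0)) (pu (pu (pu f)) (0, 0)) (ν (0, 0))| =
      2 * |deriv ε 0| ^ 2 * ‖pv (pu f) (0, 0)‖ := by
    rw [hfuu0, hfuuu0, det3_smul_add_smul_right, abs_mul, hdet, real_inner_self_eq_norm_sq, hν1,
      sq_abs, show -deriv ε 0 * (-2 * deriv ε 0) = 2 * deriv ε 0 ^ 2 by ring,
      abs_of_nonneg (by positivity : 0 ≤ 2 * deriv ε 0 ^ 2)]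
    simp
  have hκ : |(-⟪pv (pu f) (0, 0), pu ν (0, 0)⟫) / ‖pv (pu f) (0, 0)‖ ^ 2| =
      |⟪pv (pu f) (0, 0), pu ν (0, 0)⟫| / ‖pv (pu f) (0, 0)‖ ^ 2 := by
    rw [abs_div, abs_neg, abs_of_nonneg (by positivity : (0 : ℝ) ≤ ‖pv (pu f) (0, 0)‖ ^ 2)]
  rw [hτ, hκ, hnuu]
  refine hlim.congr' ?_
  filter_upwards [nhdsWithin_le_nhds h0, nhdsWithin_le_nhds h1, nhdsWithin_le_nhds h2, hεne,
    self_mem_nhdsWithin] with u hu0 hu1 hu2 hεu hune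
  have hu' : u ≠ 0 := hune
  have hfu : pu f (u, 0) = -(ε u • pv f (u, 0)) := eq_neg_of_add_eq_zero_left hu0
  have hηη : fηη (u, 0) = ε u • pv fη (u, 0) := by
    simp [fηη, hu1]
  have hηηη : fηηη (u, 0) = deriv ε u • pv fη (u, 0) +
      ε u • ((2 : ℝ) • pu (pv fη) (u, 0) + ε u • pv (pv fη) (u, 0)) := by
    simp only [fηηη, fηη, pu_add_smul hu hv hε, pv_add_smul hu hv hε, hu2, pv_pu_comm hfη]
    module
  have hκc : |κc u| = (|ε u| * ‖pv f (u, 0)‖) ^ ((3 : ℝ) / 2) *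
      (|ε u| ^ 3 * |det3 (pv f (u, 0)) (pv fη (u, 0))
        ((2 : ℝ) • pu (pv fη) (u, 0) + ε u • pv (pv fη) (u, 0))|) /
      (|ε u| ^ 2 * ‖cross3 (pv f (u, 0)) (pv fη (u, 0))‖) ^ ((5 : ℝ) / 2) := by
    simp only [κc, hηη, hηηη, hfu, det3_neg_smul_smul_add_smul]
    rw [← neg_smul, cross3_smul_smul, norm_smul, norm_smul, abs_div, abs_mul,
      abs_of_nonneg (by positivity : (0 : ℝ) ≤ (‖-ε u‖ * ‖pv f (u, 0)‖) ^ ((3 : ℝ) / 2)),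
      abs_of_nonneg (a := (‖-ε u * ε u‖ * _) ^ ((5 : ℝ) / 2)) (by positivity)]
    simp [abs_mul, sq]
  rw [hκc, rpow_scaling (abs_nonneg _) (abs_pos.2 hεu) (norm_nonneg _) (norm_nonneg _)]
  congr 3
  simp only [Pi.div_apply, Function.comp_apply, abs_div, abs_mul, abs_abs, Real.norm_eq_abs]
  field_simp
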